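/- arXiv:1310.2101 — 2 statements merged into one kernel-verified Lean document; each statement's English description precedes it below -/
import Mathlib

section
/- In the differential setting, assume conditions (C1) and (C2). Then for every index k, identically on U: 2 Σ_{i≠k} θ_{ki}/h_i = Σ_i ( 7 (h_k/h_i²) r_{ik}² − 6 r_{ik}²/h_k − 2 (h_k²/h_i³) r_{ii} r_{ik} ) + Σ_{i,j} ( (h_k²/(h_i h_j²)) r_{ij} r_{jk} − (h_k/(h_i h_j)) r_{ik} r_{jk} ). -/
open Finset

/-- Partial derivative of `f` in the `j`-th coordinate direction at `x`. -/
noncomputable def pd {N : ℕ} (f : (Fin N → ℝ) → ℝ) (j : Fin N) (x : Fin N → ℝ) : ℝ :=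
  fderiv ℝ f x (Pi.single j 1)

/-- A partial derivative is the derivative along the corresponding coordinate line. -/
theorem hasDerivAt_pd {N : ℕ} {U : Set (Fin N → ℝ)} (hU : IsOpen U)
    {f : (Fin N → ℝ) → ℝ} (hf : ContDiffOn ℝ (⊤ : ℕ∞) f U) (k : Fin N) {x : Fin N → ℝ}
    (hx : x ∈ U) :
    HasDerivAt (fun t : ℝ => f (x + t • Pi.single k 1)) (pd f k x) 0 := by
  have hd : DifferentiableAt ℝ f x :=
    (hf.contDiffAt (hU.mem_nhds hx)).differentiableAt (by simp)
  exact hd.hasFDerivAt.hasLineDerivAt (Pi.single k 1)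

/-- A coordinate line through a point of an open set stays in the set for small times. -/
theorem eventually_line_mem {N : ℕ} {U : Set (Fin N → ℝ)} (hU : IsOpen U) (k : Fin N)
    {x : Fin N → ℝ} (hx : x ∈ U) :
    ∀ᶠ t : ℝ in nhds 0, x + t • (Pi.single k 1 : Fin N → ℝ) ∈ U := by
  have hcont : Continuous fun t : ℝ => x + t • (Pi.single k 1 : Fin N → ℝ) := by fun_prop
  exact hcont.continuousAt.preimage_mem_nhds (by simpa using hU.mem_nhds hx)

/-- Functions which agree near a point have the same derivative there. -/
theorem derivative_eq_of_eventuallyEq {f g : ℝ → ℝ} {a b t : ℝ} (hf : HasDerivAt f a t)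
    (hg : HasDerivAt g b t) (hfg : ∀ᶠ s in nhds t, f s = g s) : a = b :=
  hf.unique (hg.congr_of_eventuallyEq hfg)

/-- The derivative of `∑ r i j / (h i * h j) - 2 * ∑ r i i / h i ^ 2`, in terms of the
derivatives `D` of `r`, when the derivative of `h i` is `r i k * h k`. -/
theorem hasDerivAt_correlator {ι : Type*} [Fintype ι] (k : ι) (h : ι → ℝ → ℝ)
    (r : ι → ι → ℝ → ℝ) (D : ι → ι → ℝ) (hne : ∀ i, h i 0 ≠ 0)
    (hh : ∀ i, HasDerivAt (h i) (r i k 0 * h k 0) 0)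
    (hr : ∀ i j, HasDerivAt (r i j) (D i j) 0) :
    HasDerivAt (fun t => (∑ i, ∑ j, r i j t / (h i t * h j t)) - 2 * ∑ i, r i i t / (h i t) ^ 2)
      ((∑ i, ∑ j, (D i j * (h i 0)⁻¹ * (h j 0)⁻¹
          - h k 0 * (r i j 0 * r i k 0 * (h i 0)⁻¹ ^ 2 * (h j 0)⁻¹)
          - h k 0 * (r i j 0 * r j k 0 * (h i 0)⁻¹ * (h j 0)⁻¹ ^ 2)))
        - 2 * ∑ i, (D i i * (h i 0)⁻¹ ^ 2 - 2 * h k 0 * (r i i 0 * r i k 0 * (h i 0)⁻¹ ^ 3))) 0 := by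
  refine HasDerivAt.sub (HasDerivAt.fun_sum fun i _ => HasDerivAt.fun_sum fun j _ => ?_)
    ((HasDerivAt.fun_sum fun i _ => ?_).const_mul 2)
  · refine ((hr i j).fun_div ((hh i).fun_mul (hh j)) (mul_ne_zero (hne i) (hne j))).congr_deriv ?_
    have := hne i
    have := hne j
    field_simp
    ring
  · refine ((hr i i).fun_div ((hh i).fun_pow 2) (pow_ne_zero 2 (hne i))).congr_deriv ?_
    have := hne i
    field_simp
    ring

/-- The linear algebra behind the elimination: `c` and `d` are the off-diagonal and diagonal
corrections to the derivatives of `r`, and `g` is the inverse of `h`. -/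
theorem two_mul_sum_eq_of_corrections {ι : Type*} [Fintype ι] [DecidableEq ι] (k : ι)
    (h g c d : ι → ℝ) (r D : ι → ι → ℝ) (hg : ∀ i, h i * g i = 1)
    (rsymm : ∀ i j, r i j = r j i) (hc : c k = 0)
    (hD : ∀ i j, D i j = r i k * r j k + (if i = k then c j else 0) + (if j = k then c i else 0)
      + (if i = j then d i else 0))
    (hC1 : (∑ i, ∑ j, (D i j * g i * g j - h k * (r i j * r i k * g i ^ 2 * g j)
          - h k * (r i j * r j k * g i * g j ^ 2)))
        - 2 * ∑ i, (D i i * g i ^ 2 - 2 * h k * (r i i * r i k * g i ^ 3)) = 0)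
    (hG1 : (∑ j, r k j ^ 2) - r k k ^ 2 = -(1 / 12) * (2 * r k k * h k * (∑ j, r k j * g j)
      + h k * (∑ i, c i * g i) + d k - h k ^ 2 * ∑ j, r k j ^ 2 * g j ^ 2))
    (hG2 : ∀ i, i ≠ k → h k * d i * g i ^ 2 + c i * g i = 12 * h k * (r i k ^ 2 * g i ^ 2)
      + ∑ l, (h k ^ 2 * (r i l * r l k * g i * g l ^ 2) - h k ^ 2 * (r i l * r i k * g i ^ 2 * g l)
        - h k * (r i k * r l k * g i * g l))) :
    2 * ∑ i, c i * g i = 7 * h k * (∑ i, r i k ^ 2 * g i ^ 2) - 6 * g k * (∑ i, r i k ^ 2)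
      - 2 * h k ^ 2 * (∑ i, r i i * r i k * g i ^ 3)
      + h k ^ 2 * (∑ i, ∑ j, r i j * r j k * g i * g j ^ 2)
      - h k * ∑ i, ∑ j, r i k * r j k * g i * g j := by
  have swap : ∑ i, ∑ j, r i j * r i k * g i ^ 2 * g j = ∑ i, ∑ j, r i j * r j k * g i * g j ^ 2 := by
    rw [sum_comm]
    refine sum_congr rfl fun i _ => sum_congr rfl fun j _ => ?_
    rw [rsymm j i]; ring
  have hdiff : ∑ i, (h k * d i * g i ^ 2 + c i * g i - (12 * h k * (r i k ^ 2 * g i ^ 2)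
      + ∑ l, (h k ^ 2 * (r i l * r l k * g i * g l ^ 2) - h k ^ 2 * (r i l * r i k * g i ^ 2 * g l)
        - h k * (r i k * r l k * g i * g l))))
      = -12 * g k * (∑ i, r i k ^ 2) - ∑ i, c i * g i := by
    rw [sum_eq_single k (fun i _ hi => by rw [hG2 i hi, sub_self]) (by simp)]
    have e1 : ∑ l, (h k ^ 2 * (r k l * r l k * g k * g l ^ 2)
        - h k ^ 2 * (r k l * r k k * g k ^ 2 * g l) - h k * (r k k * r l k * g k * g l))
        = h k * (∑ l, r k l ^ 2 * g l ^ 2) - 2 * r k k * ∑ l, r k l * g l := by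
      simp only [mul_sum, ← sum_sub_distrib]
      refine sum_congr rfl fun l _ => ?_
      rw [rsymm l k]
      linear_combination (h k * r k l ^ 2 * g l ^ 2 - r k l * r k k * g l * (h k * g k + 1)
        - r k k * r k l * g l) * hg k
    have e2 : ∑ i, r i k ^ 2 = ∑ j, r k j ^ 2 := sum_congr rfl fun i _ => by rw [rsymm]
    rw [e1, e2, hc]
    linear_combination (12 * g k) * hG1 + (g k * d k - 12 * g k * r k k ^ 2
      - 2 * r k k * (∑ j, r k j * g j) - ∑ i, c i * g i
      + h k * ∑ j, r k j ^ 2 * g j ^ 2) * hg k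
  have hsum : ∑ i, ∑ j, D i j * g i * g j = (∑ i, ∑ j, r i k * r j k * g i * g j)
      + 2 * g k * (∑ i, c i * g i) + ∑ i, d i * g i ^ 2 := by
    simp only [hD, add_mul, sum_add_distrib, ite_mul, zero_mul, sum_ite_eq, sum_ite_eq', mem_univ,
      mul_sum]
    rw [sum_comm (f := fun i j => if i = k then c j * g i * g j else 0)]
    simp only [sum_ite_eq', mem_univ, if_true]
    have : ∀ i, 2 * g k * (c i * g i) = c i * g k * g i + c i * g i * g k := fun i => by ring
    simp only [this, sum_add_distrib, pow_two, mul_assoc]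
    ring
  have hdiag : ∑ i, D i i * g i ^ 2 = (∑ i, r i k ^ 2 * g i ^ 2) + ∑ i, d i * g i ^ 2 := by
    rw [← sum_add_distrib]
    refine sum_congr rfl fun i _ => ?_
    rw [hD]
    by_cases hi : i = k
    · subst hi; simp [hc]; ring
    · simp [hi]; ring
  simp only [sum_sub_distrib, sum_add_distrib, mul_assoc, ← mul_sum] at hC1 hdiff hsum hdiag swap ⊢
  rw [hsum, hdiag, swap] at hC1
  rw [swap] at hdiff
  linear_combination (1 / 2) * hdiff + (h k / 2) * hC1 - (∑ i, c i * g i) * hg k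

theorem sum_theta_formula
    (N : ℕ) (hN : 2 ≤ N)
    (U : Set (Fin N → ℝ)) (hUopen : IsOpen U) (hUconn : IsConnected U)
    (hdist : ∀ x ∈ U, ∀ i j : Fin N, i ≠ j → x i ≠ x j)
    (h : Fin N → (Fin N → ℝ) → ℝ)
    (hsmooth : ∀ i, ContDiffOn ℝ (⊤ : ℕ∞) (h i) U)
    (hne : ∀ i, ∀ x ∈ U, h i x ≠ 0)
    (r : Fin N → Fin N → (Fin N → ℝ) → ℝ)
    (rsmooth : ∀ i j, ContDiffOn ℝ (⊤ : ℕ∞) (r i j) U)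
    (rsymm : ∀ i j, r i j = r j i)
    (hb : ∀ i j, ∀ x ∈ U, pd (h i) j x = r i j x * h j x)
    (hstring : ∀ i, ∀ x ∈ U, ∑ j, r i j x * h j x = 0)
    (v : Fin N → Fin N → (Fin N → ℝ) → ℝ)
    (hv : ∀ i j, ∀ x ∈ U, v i j x = (x j - x i) * r i j x)
    (θ : Fin N → Fin N → (Fin N → ℝ) → ℝ)
    (hθ : ∀ i j, i ≠ j → ∀ x ∈ U,
      θ i j x = (r i j x + ∑ k, r i k x * v j k x) / (x j - x i))
    (Ω : Fin N → Fin N → (Fin N → ℝ) → ℝ)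
    (hΩ : ∀ i j, i ≠ j → ∀ x ∈ U,
      Ω i j x = (θ i j x - θ j i x + ∑ k, ∑ l, r i l x * r j k x * v k l x) / (x j - x i))
    (hc : ∀ i j k : Fin N, i ≠ j → j ≠ k → i ≠ k → ∀ x ∈ U,
      pd (r i j) k x = r i k x * r j k x)
    (hd : ∀ i j, i ≠ j → ∀ x ∈ U, pd (r i j) i x = r i i x * r i j x + θ i j x)
    (he : ∀ i k, k ≠ i → ∀ x ∈ U,
      pd (r i i) k x = (r i k x) ^ 2 + (h k x / h i x) * θ i k x)
    (hf : ∀ i, ∀ x ∈ U, pd (r i i) i x =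
      (r i i x) ^ 2 - 2 * ∑ l, (r i l x) ^ 2
        + ∑ p ∈ univ.filter (fun p => p ≠ i), (h p x / h i x) * θ p i x)
    (hC1 : ∃ c : ℝ, ∀ x ∈ U,
      (∑ i, ∑ j, r i j x / (h i x * h j x)) - 2 * ∑ i, r i i x / (h i x) ^ 2 = c)
    (hG1 : ∀ i, ∀ x ∈ U,
      ∑ j, r i j x * v i j x = -(1/12) * ∑ j, r i j x * h i x / h j x)
    (hG2 : ∀ i j, i ≠ j → ∀ x ∈ U,
      θ i j x * h j x / h i x + θ j i x * h i x / h j x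
        = 12 * (r i j x) ^ 2
          + ∑ l, (r i l x * r j l x * h i x * h j x / (h l x) ^ 2
              - r i j x * r i l x * h j x / h l x - r i j x * r j l x * h i x / h l x))
    :
    ∀ k : Fin N, ∀ x ∈ U,
      2 * ∑ i ∈ univ.filter (fun i => i ≠ k), θ k i x / h i x
        = (∑ i, (7 * (h k x / (h i x) ^ 2) * (r i k x) ^ 2
              - 6 * (r i k x) ^ 2 / h k x
              - 2 * ((h k x) ^ 2 / (h i x) ^ 3) * (r i i x * r i k x)))
          + ∑ i, ∑ j, ((h k x) ^ 2 / (h i x * (h j x) ^ 2) * (r i j x * r j k x)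
              - (h k x / (h i x * h j x)) * (r i k x * r j k x)) := by
  intro k x hx
  set γ : ℝ → Fin N → ℝ := fun t => x + t • Pi.single k 1 with hγ
  have γ0 : γ 0 = x := by simp [hγ]
  have hline : ∀ᶠ t : ℝ in nhds 0, γ t ∈ U := eventually_line_mem hUopen k hx
  have hcoord : ∀ i, HasDerivAt (fun t => γ t i) (if i = k then 1 else 0) 0 := by
    intro i
    have := ((hasDerivAt_id (0 : ℝ)).mul_const ((Pi.single k 1 : Fin N → ℝ) i)).const_add (x i)
    simpa [hγ, Pi.single_apply] using this
  have hder : ∀ i, HasDerivAt (fun t => h i (γ t)) (r i k x * h k x) 0 := fun i => by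
    rw [← hb i k x hx]; exact hasDerivAt_pd hUopen (hsmooth i) k hx
  have rder : ∀ i j, HasDerivAt (fun t => r i j (γ t)) (pd (r i j) k x) 0 := fun i j =>
    hasDerivAt_pd hUopen (rsmooth i j) k hx
  have hne' : ∀ i, h i x ≠ 0 := fun i => hne i x hx
  have rs : ∀ i j, r i j x = r j i x := fun i j => by rw [rsymm]
  set c : Fin N → ℝ := fun i => if i = k then 0 else θ k i x with hcdef
  set d : Fin N → ℝ := fun i => if i = k then
    -2 * ∑ l, (r k l x) ^ 2 + ∑ p ∈ univ.filter (fun p => p ≠ k), (h p x / h k x) * θ p k x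
    else (h k x / h i x) * θ i k x with hddef
  have hD : ∀ i j, pd (r i j) k x = r i k x * r j k x + (if i = k then c j else 0)
      + (if j = k then c i else 0) + (if i = j then d i else 0) := by
    intro i j
    by_cases hij : i = j
    · subst hij
      by_cases hik : i = k
      · subst hik
        rw [hf i x hx]; simp [hcdef, hddef]; ring
      · rw [he i k (Ne.symm hik) x hx]; simp [hddef, hik]; ring
    · by_cases hik : i = k
      · subst hik
        rw [hd i j hij x hx]; simp [hcdef, hij, Ne.symm hij, rs j i]
      · by_cases hjk : j = k
        · subst hjk
          rw [rsymm i j, hd j i (Ne.symm hij) x hx]; simp [hcdef, hij]; ring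
        · rw [hc i j k hij hjk hik x hx]; simp [hij, hik, hjk]
  have hC1' : (∑ i, ∑ j, (pd (r i j) k x * (h i x)⁻¹ * (h j x)⁻¹
          - h k x * (r i j x * r i k x * (h i x)⁻¹ ^ 2 * (h j x)⁻¹)
          - h k x * (r i j x * r j k x * (h i x)⁻¹ * (h j x)⁻¹ ^ 2)))
        - 2 * ∑ i, (pd (r i i) k x * (h i x)⁻¹ ^ 2
          - 2 * h k x * (r i i x * r i k x * (h i x)⁻¹ ^ 3)) = 0 := by
    obtain ⟨C, hC⟩ := hC1
    have key := hasDerivAt_correlator k (fun i t => h i (γ t)) (fun i j t => r i j (γ t))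
      (fun i j => pd (r i j) k x) (by simpa [γ0] using hne') (by simpa [γ0] using hder) rder
    simp only [γ0] at key
    exact derivative_eq_of_eventuallyEq key (hasDerivAt_const 0 C)
      (hline.mono fun t ht => hC _ ht)
  have hskew : ∑ j, ∑ l, r k j x * (r k l x * v j l x) = 0 := by
    have : ∑ j, ∑ l, r k j x * (r k l x * v j l x)
        = - ∑ j, ∑ l, r k j x * (r k l x * v j l x) := by
      conv_lhs => rw [sum_comm]
      simp only [← sum_neg_distrib]
      refine sum_congr rfl fun i _ => sum_congr rfl fun j _ => ?_
      rw [hv _ _ x hx, hv _ _ x hx, rs j i]; ring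
    linarith
  have hG1' : (∑ j, r k j x ^ 2) - r k k x ^ 2
      = -(1 / 12) * (2 * r k k x * h k x * (∑ j, r k j x * (h j x)⁻¹)
      + h k x * (∑ i, c i * (h i x)⁻¹) + d k - h k x ^ 2 * ∑ j, r k j x ^ 2 * (h j x)⁻¹ ^ 2) := by
    have dl : HasDerivAt (fun t => ∑ j, (γ t j - γ t k) * r k j (γ t) ^ 2)
        (∑ j, (((if j = k then 1 else 0) - 1) * r k j x ^ 2
          + (x j - x k) * (2 * r k j x * pd (r k j) k x))) 0 := by
      refine HasDerivAt.fun_sum fun j _ => ?_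
      refine (((hcoord j).fun_sub (hcoord k)).fun_mul ((rder k j).fun_pow 2)).congr_deriv ?_
      simp [γ0]
    have dr : HasDerivAt (fun t => -(1/12) * (h k (γ t) * ∑ j, r k j (γ t) / h j (γ t)))
        (-(1/12) * (r k k x * h k x * (∑ j, r k j x * (h j x)⁻¹)
          + h k x * ∑ j, (pd (r k j) k x * (h j x)⁻¹
            - h k x * (r k j x ^ 2 * (h j x)⁻¹ ^ 2)))) 0 := by
      refine HasDerivAt.const_mul _ ?_
      have : HasDerivAt (fun t => ∑ j, r k j (γ t) / h j (γ t))
          (∑ j, (pd (r k j) k x * (h j x)⁻¹ - h k x * (r k j x ^ 2 * (h j x)⁻¹ ^ 2))) 0 := by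
        refine HasDerivAt.fun_sum fun j _ => ?_
        refine ((rder k j).fun_div (hder j) (by simpa [γ0] using hne' j)).congr_deriv ?_
        have := hne' j
        rw [γ0, rs j k]
        field_simp
      refine ((hder k).fun_mul this).congr_deriv ?_
      simp [γ0, div_eq_mul_inv]
    have e := derivative_eq_of_eventuallyEq dl dr (hline.mono fun t ht => by
      have := hG1 k (γ t) ht
      rw [mul_sum]
      convert this using 1
      · refine sum_congr rfl fun j _ => ?_
        rw [hv _ _ _ ht]; ring
      · congr 1
        refine sum_congr rfl fun j _ => ?_
        ring)
    have eL : ∑ j, (((if j = k then 1 else 0) - 1) * r k j x ^ 2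
          + (x j - x k) * (2 * r k j x * pd (r k j) k x))
          = (∑ j, r k j x ^ 2) - r k k x ^ 2 := by
      have hterm : ∀ j, ((if j = k then 1 else 0) - 1) * r k j x ^ 2
          + (x j - x k) * (2 * r k j x * pd (r k j) k x)
          = r k j x ^ 2 + 2 * r k k x * (r k j x * v k j x)
            + 2 * (∑ l, r k j x * (r k l x * v j l x))
            - (if j = k then r k k x ^ 2 + 2 * ∑ l, r k k x * (r k l x * v k l x) else 0) := by
        intro j
        by_cases hj : j = k
        · subst hj
          simp [hv j j x hx]
        · have h1 := hθ k j (Ne.symm hj) x hx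
          have hsub : x j - x k ≠ 0 := sub_ne_zero.mpr (hdist x hx j k hj)
          rw [eq_div_iff hsub] at h1
          rw [hd k j (Ne.symm hj) x hx, hv k j x hx, ← mul_sum]
          simp only [hj, if_false]
          linear_combination (2 * r k j x) * h1
      simp only [hterm, sum_sub_distrib, sum_add_distrib, ← mul_sum, sum_ite_eq', mem_univ, if_true]
      simp only [← mul_sum] at hskew
      linear_combination 2 * hskew
    have eR : ∑ j, (pd (r k j) k x * (h j x)⁻¹ - h k x * (r k j x ^ 2 * (h j x)⁻¹ ^ 2))
        = r k k x * (∑ j, r k j x * (h j x)⁻¹) + (∑ i, c i * (h i x)⁻¹) + d k * (h k x)⁻¹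
          - h k x * ∑ j, r k j x ^ 2 * (h j x)⁻¹ ^ 2 := by
      have hck : c k = 0 := by simp [hcdef]
      rw [sum_sub_distrib, ← mul_sum]
      congr 1
      have hterm : ∀ j, pd (r k j) k x * (h j x)⁻¹ = r k k x * (r k j x * (h j x)⁻¹)
          + c j * (h j x)⁻¹ + (if k = j then d k * (h j x)⁻¹ else 0) := by
        intro j
        rw [hD, hck, rs j k]
        by_cases hj : k = j
        · simp [hj]; ring
        · simp [hj]; ring
      simp only [hterm, sum_add_distrib, ← mul_sum, sum_ite_eq, mem_univ, if_true]
    rw [eL, eR] at e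
    rw [e]
    linear_combination (-(1 / 12) * d k) * mul_inv_cancel₀ (hne' k)
  have hG2' : ∀ i, i ≠ k → h k x * d i * (h i x)⁻¹ ^ 2 + c i * (h i x)⁻¹
      = 12 * h k x * (r i k x ^ 2 * (h i x)⁻¹ ^ 2)
      + ∑ l, (h k x ^ 2 * (r i l x * r l k x * (h i x)⁻¹ * (h l x)⁻¹ ^ 2)
        - h k x ^ 2 * (r i l x * r i k x * (h i x)⁻¹ ^ 2 * (h l x)⁻¹)
        - h k x * (r i k x * r l k x * (h i x)⁻¹ * (h l x)⁻¹)) := by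
    intro i hi
    have e := congrArg (fun y => h k x * (h i x)⁻¹ ^ 2 * y) (hG2 i k hi x hx)
    have h1 := hne' i
    have h2 := hne' k
    simp only [mul_add, mul_sum] at e
    convert e using 1
    · simp only [hcdef, hddef, hi, if_false]
      field_simp
    · congr 1
      · ring
      · refine sum_congr rfl fun l _ => ?_
        have h3 := hne' l
        rw [rs l k]
        field_simp
  have main := two_mul_sum_eq_of_corrections k (fun i => h i x) (fun i => (h i x)⁻¹) c d
    (fun i j => r i j x) (fun i j => pd (r i j) k x) (fun i => mul_inv_cancel₀ (hne' i)) rs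
    (by simp [hcdef]) hD hC1' hG1' hG2'
  have hL : ∑ i ∈ univ.filter (fun i => i ≠ k), θ k i x / h i x = ∑ i, c i * (h i x)⁻¹ := by
    rw [sum_filter]
    refine sum_congr rfl fun i _ => ?_
    by_cases hi : i = k <;> simp [hcdef, hi, div_eq_mul_inv]
  rw [hL, main]
  simp only [mul_sum, ← sum_sub_distrib, add_sub_assoc]
  congr 1
  · refine sum_congr rfl fun i _ => ?_
    ring
  · refine sum_congr rfl fun i _ => sum_congr rfl fun j _ => ?_
    ring
end

section
/- In the differential setting, assume conditions (C1) and (C2), and set Ω̃_{ij} := Ω_{ij} ( h_i/h_j − h_j/h_i ) for i ≠ j. Then for all i ≠ j, identically on U: 0 = Ω̃_{ij} + θ_{ij} ( 20 r_{ij} + 4 r_{ii} h_j/h_i − Σ_k ( r_{ik} h_j/h_k + r_{jk} h_i/h_k ) ) + 2 Σ_{k≠i} θ_{ik} r_{jk} h_j/h_i + 24 r_{ii}² r_{ij} h_j/h_i + 24 r_{ij}³ h_i/h_j − 12 Σ_k r_{ik}² r_{jk} h_j/h_k + 4 Σ_k r_{ij} r_{ik} r_{jk} h_i²/h_k² − 4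 Σ_k r_{ij}² r_{ik} h_i/h_k − 4 Σ_k r_{ii} r_{ij} r_{ik} h_j/h_k − 3 Σ_k r_{ij} r_{ik}² h_i h_j/h_k² − 4 Σ_k r_{ik}² r_{ij} h_j/h_i + 2 Σ_k r_{ij} r_{kk} r_{ik} h_i² h_j/h_k³ − 2 Σ_k r_{ij}² r_{jk} h_i²/(h_k h_j) − 2 Σ_k r_{ik}² r_{jk} h_i² h_j/h_k³ − Σ_{k,l} r_{ij} r_{kl} r_{li} h_i² h_j/(h_k h_l²) + Σ_{k,l} r_{ij} r_{ik} r_{li} h_i h_j/(h_k h_l) − Σ_{k,l} r_{kl} r_{jl} r_{ik} h_i h_j/h_l² − Σ_{k,l} r_{il} r_{kl} r_{jk} h_i h_j/h_l² + Σ_{k,l} r_{ik} r_{il} r_{jk} h_j/h_l + Σ_{k,l} r_{ik} r_{kl} r_{jk} h_i h_j/(h_k h_l). -/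
open Finset

section Algebra

variable {ι : Type*} [Fintype ι]

theorem theta_add_theta_swap (R : ι → ι → ℝ) (Rsymm : ∀ a b, R a b = R b a) (u : ι → ℝ)
    (i j : ι) (hu : u i ≠ u j) :
    (R i j + ∑ k, R i k * ((u k - u j) * R j k)) / (u j - u i)
      + (R j i + ∑ k, R j k * ((u k - u i) * R i k)) / (u i - u j)
      = -∑ k, R i k * R j k := by
  have h1 : u i - u j ≠ 0 := sub_ne_zero.mpr hu
  have h2 : u j - u i ≠ 0 := sub_ne_zero.mpr hu.symm
  have key : ∑ k, R i k * ((u k - u j) * R j k) =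
      ∑ k, R j k * ((u k - u i) * R i k) - (u j - u i) * ∑ k, R i k * R j k := by
    rw [mul_sum, ← sum_sub_distrib]
    exact sum_congr rfl fun k _ => by ring
  rw [key, Rsymm j i, div_add_div _ _ h2 h1, div_eq_iff (mul_ne_zero h2 h1)]
  ring

variable [DecidableEq ι]

/-- The sum of the reduced genus-one relations over the second index, with weights `w`. -/
theorem sum_relation_weighted (R : ι → ι → ℝ)
    (H t w : ι → ℝ) (i : ι) (t_self : t i = 0)
    (hrel : ∀ k, k ≠ i → t k * H k * (H i)⁻¹ + (-t k - ∑ l, R i l * R k l) * H i * (H k)⁻¹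
      - 12 * R i k ^ 2 - H i * H k * ∑ l, R i l * R k l * (H l)⁻¹ ^ 2
      + R i k * H k * ∑ l, R i l * (H l)⁻¹ + R i k * H i * ∑ l, R k l * (H l)⁻¹ = 0)
    (hi : H i ≠ 0) :
    (H i)⁻¹ * ∑ k, t k * H k * w k - H i * ∑ k, t k * (H k)⁻¹ * w k
      - H i * ∑ k, ∑ l, R i l * R k l * (H k)⁻¹ * w k
      - 12 * ∑ k, R i k ^ 2 * w k
      - H i * ∑ k, ∑ l, R i l * R k l * (H l)⁻¹ ^ 2 * (H k * w k)
      + (∑ l, R i l * (H l)⁻¹) * ∑ k, R i k * H k * w k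
      + H i * ∑ k, ∑ l, R i k * R k l * (H l)⁻¹ * w k
      = (- ∑ l, R i l ^ 2 - 12 * R i i ^ 2 - H i ^ 2 * ∑ l, R i l ^ 2 * (H l)⁻¹ ^ 2
        + 2 * R i i * H i * ∑ l, R i l * (H l)⁻¹) * w i := by
  have e : ∀ k, (t k * H k * (H i)⁻¹ + (-t k - ∑ l, R i l * R k l) * H i * (H k)⁻¹
      - 12 * R i k ^ 2 - H i * H k * ∑ l, R i l * R k l * (H l)⁻¹ ^ 2
      + R i k * H k * ∑ l, R i l * (H l)⁻¹ + R i k * H i * ∑ l, R k l * (H l)⁻¹) * w k =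
      if k = i then (- ∑ l, R i l ^ 2 - 12 * R i i ^ 2 - H i ^ 2 * ∑ l, R i l ^ 2 * (H l)⁻¹ ^ 2
        + 2 * R i i * H i * ∑ l, R i l * (H l)⁻¹) * w i else 0 := by
    intro k
    split_ifs with hk
    · subst hk
      rw [t_self]
      simp only [← pow_two]
      field_simp
      ring
    · rw [hrel k hk, zero_mul]
  have e2 := Finset.sum_congr (rfl : (univ : Finset ι) = univ) fun k _ => e k
  rw [sum_ite_eq' univ i, if_pos (mem_univ i)] at e2
  rw [← e2]
  simp only [mul_sum, sum_mul, add_mul, sub_mul, sum_add_distrib, sum_sub_distrib]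
  congr 1
  · congr 1
    · congr 1
      · congr 1
        · rw [← sub_eq_zero]
          simp only [← sum_add_distrib, ← sum_sub_distrib, neg_mul]
          refine sum_eq_zero fun k _ => ?_
          have : ∑ l, H i * (R i l * R k l * (H k)⁻¹ * w k) =
            ∑ l, R i l * R k l * H i * (H k)⁻¹ * w k := sum_congr rfl fun l _ => by ring
          rw [this]; ring
        · exact sum_congr rfl fun k _ => by ring
      · exact sum_congr rfl fun k _ => sum_congr rfl fun l _ => by ring
    · exact sum_congr rfl fun k _ => sum_congr rfl fun l _ => by ring
  · exact sum_congr rfl fun k _ => sum_congr rfl fun l _ => by ring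

end Algebra

section Calculus

variable {ι : Type*} [Fintype ι] [DecidableEq ι]

theorem hasDerivAt_theta (R : ι → ι → ℝ) (Rsymm : ∀ a b, R a b = R b a) (U t : ι → ℝ)
    (i j : ι) (hij : i ≠ j) (hU : U i ≠ U j) (ρ c S : ℝ) (u a b : ι → ℝ → ℝ)
    (hu0 : ∀ k, u k 0 = U k) (ha0 : ∀ k, a k 0 = R i k) (hb0 : ∀ k, b k 0 = R j k)
    (hu : ∀ k, HasDerivAt (u k) (if k = i then 1 else 0) 0)
    (ha : ∀ k, HasDerivAt (a k) (R i i * R i k + t k + if k = i then ρ else 0) 0)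
    (hb : ∀ k, HasDerivAt (b k)
      (R i j * R i k + (if k = i then t j else 0) + if k = j then c else 0) 0)
    (ht : ∀ k, k ≠ i → t k * (U k - U i) = R i k + ∑ l, R i l * ((U l - U k) * R k l))
    (hS : S = (R j i + ∑ k, R j k * ((U k - U i) * R i k)) / (U i - U j)) :
    HasDerivAt (fun s => (b i s + ∑ k, b k s * ((u k s - u i s) * a k s)) / (u i s - u j s))
      (R i i * S - R i j * c -
        (t j - S + ∑ k, ∑ l, R i l * R j k * ((U l - U k) * R k l)) / (U j - U i)) 0 := by
  have hq : U i - U j ≠ 0 := sub_ne_zero.mpr hU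
  have hq' : U j - U i ≠ 0 := sub_ne_zero.mpr hU.symm
  have hd := ((hb i).add (HasDerivAt.fun_sum (u := univ) fun k _ =>
    (hb k).mul (((hu k).sub (hu i)).mul (ha k)))).div ((hu i).sub (hu j))
    (by simpa [hu0] using hq)
  refine HasDerivAt.congr_deriv hd ?_
  simp only [Pi.mul_apply, Pi.add_apply, Pi.sub_apply, hu0, ha0, hb0, if_true, if_neg hij,
    if_neg hij.symm, add_zero, sub_zero]
  set W := ∑ k, ∑ l, R i l * R j k * ((U l - U k) * R k l)
  have hSq : ∑ k, R j k * ((U k - U i) * R i k) = S * (U i - U j) - R j i := by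
    rw [hS]; field_simp; ring
  have hT : ∑ k, R j k * ((U k - U i) * t k) = ∑ k, R j k * R i k + W - R j i * R i i
      - R j i * ∑ l, R i l * ((U l - U i) * R i l) := by
    have e : ∀ k, R j k * ((U k - U i) * t k) = R j k * R i k
        + (∑ l, R i l * R j k * ((U l - U k) * R k l))
        - if k = i then R j i * R i i + R j i * ∑ l, R i l * ((U l - U i) * R i l) else 0 := by
      intro k
      have e' : ∑ l, R i l * R j k * ((U l - U k) * R k l)
          = R j k * ∑ l, R i l * ((U l - U k) * R k l) := by
        rw [mul_sum]; exact sum_congr rfl fun l _ => by ring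
      rw [e']
      split_ifs with hk
      · subst hk; ring
      · rw [mul_comm (U k - U i), ht k hk]; ring
    rw [sum_congr rfl fun k _ => e k, sum_sub_distrib, sum_add_distrib,
      sum_ite_eq' univ i, if_pos (mem_univ i)]
    ring
  have hnum : ∑ k, ((R i j * R i k + (if k = i then t j else 0) + if k = j then c else 0)
        * ((U k - U i) * R i k)
      + R j k * (((if k = i then 1 else 0) - 1) * R i k
        + (U k - U i) * (R i i * R i k + t k + if k = i then ρ else 0)))
      = R i j * ∑ l, R i l * ((U l - U i) * R i l) + c * ((U j - U i) * R i j)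
        + R j i * R i i - ∑ k, R j k * R i k
        + R i i * ∑ k, R j k * ((U k - U i) * R i k) + ∑ k, R j k * ((U k - U i) * t k) := by
    have e : ∀ k, ((R i j * R i k + (if k = i then t j else 0) + if k = j then c else 0)
        * ((U k - U i) * R i k)
      + R j k * (((if k = i then 1 else 0) - 1) * R i k
        + (U k - U i) * (R i i * R i k + t k + if k = i then ρ else 0)))
      = R i j * (R i k * ((U k - U i) * R i k))
        + (if k = j then c * ((U j - U i) * R i j) else 0)
        + (if k = i then R j i * R i i else 0) - R j k * R i k
        + R i i * (R j k * ((U k - U i) * R i k)) + R j k * ((U k - U i) * t k) := by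
      intro k
      by_cases hk : k = i
      · subst hk; simp [hij]
      · by_cases hk' : k = j
        · subst hk'; simp [hk]; ring
        · simp [hk, hk']; ring
    rw [sum_congr rfl fun k _ => e k]
    simp only [sum_add_distrib, sum_sub_distrib, ← mul_sum, sum_ite_eq', mem_univ, if_true]
  rw [hnum, hT, hSq, Rsymm j i]
  field_simp
  ring

end Calculus

section CalculusRelations

variable {ι : Type*} [Fintype ι] [DecidableEq ι]

theorem deriv_reduced_relation_eq_zero (R : ι → ι → ℝ) (H t : ι → ℝ)
    (i j : ι) (hij : i ≠ j) (hH : ∀ k, H k ≠ 0) (ρ c S dS : ℝ) (a b h : ι → ℝ → ℝ) (σ : ℝ → ℝ)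
    (hh0 : ∀ k, h k 0 = H k) (ha0 : ∀ k, a k 0 = R i k) (hb0 : ∀ k, b k 0 = R j k) (hσ0 : σ 0 = S)
    (hh : ∀ k, HasDerivAt (h k) (R i k * H i) 0)
    (ha : ∀ k, HasDerivAt (a k) (R i i * R i k + t k + if k = i then ρ else 0) 0)
    (hb : ∀ k, HasDerivAt (b k)
      (R i j * R i k + (if k = i then t j else 0) + if k = j then c else 0) 0)
    (hσ : HasDerivAt σ dS 0)
    (hG : ∀ᶠ s in nhds 0, (-σ s - ∑ l, a l s * b l s) * h j s * (h i s)⁻¹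
      + σ s * h i s * (h j s)⁻¹ - 12 * a j s ^ 2
      - h i s * h j s * ∑ l, a l s * b l s * (h l s)⁻¹ ^ 2
      + a j s * h j s * ∑ l, a l s * (h l s)⁻¹ + a j s * h i s * ∑ l, b l s * (h l s)⁻¹ = 0) :
    -(dS + (R i i * ∑ l, R i l * R j l + ∑ l, t l * R j l + ρ * R j i + R i j * ∑ l, R i l ^ 2
        + R i i * t j + R i j * c)) * H j * (H i)⁻¹
      + (-S - ∑ l, R i l * R j l) * (R i j - H j * (R i i * (H i)⁻¹))
      + dS * H i * (H j)⁻¹ + S * (R i i * H i * (H j)⁻¹ - H i * (R i j * H i * (H j)⁻¹ ^ 2))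
      - 24 * R i j * (R i i * R i j + t j)
      - (R i i * H i * H j + H i * (R i j * H i)) * ∑ l, R i l * R j l * (H l)⁻¹ ^ 2
      - H i * H j * (R i i * ∑ l, R i l * R j l * (H l)⁻¹ ^ 2 + ∑ l, t l * R j l * (H l)⁻¹ ^ 2
        + ρ * R j i * (H i)⁻¹ ^ 2 + R i j * ∑ l, R i l ^ 2 * (H l)⁻¹ ^ 2
        + R i i * t j * (H i)⁻¹ ^ 2 + R i j * c * (H j)⁻¹ ^ 2
        - 2 * H i * ∑ l, R i l ^ 2 * R j l * (H l)⁻¹ ^ 3)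
      + ((R i i * R i j + t j) * H j + R i j * (R i j * H i)) * ∑ l, R i l * (H l)⁻¹
      + R i j * H j * (R i i * ∑ l, R i l * (H l)⁻¹ + ∑ l, t l * (H l)⁻¹ + ρ * (H i)⁻¹
        - H i * ∑ l, R i l ^ 2 * (H l)⁻¹ ^ 2)
      + ((R i i * R i j + t j) * H i + R i j * (R i i * H i)) * ∑ l, R j l * (H l)⁻¹
      + R i j * H i * (R i j * ∑ l, R i l * (H l)⁻¹ + t j * (H i)⁻¹ + c * (H j)⁻¹
        - H i * ∑ l, R i l * R j l * (H l)⁻¹ ^ 2) = 0 := by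
  have hg : ∀ k, HasDerivAt (fun s => (h k s)⁻¹) (-(R i k * H i * (H k)⁻¹ ^ 2)) 0 := fun k => by
    refine ((hh k).fun_inv (by simpa [hh0] using hH k)).congr_deriv ?_
    rw [hh0]; field_simp
  have hC0 : HasDerivAt (fun s => ∑ l, a l s * b l s)
      (R i i * ∑ l, R i l * R j l + ∑ l, t l * R j l + ρ * R j i + R i j * ∑ l, R i l ^ 2
        + R i i * t j + R i j * c) 0 := by
    refine (HasDerivAt.fun_sum fun k _ => (ha k).mul (hb k)).congr_deriv ?_
    simp only [ha0, hb0, mul_add, add_mul, sum_add_distrib, mul_sum, ite_mul, mul_ite, mul_zero,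
      zero_mul, sum_ite_eq', mem_univ, if_true]
    rw [← sub_eq_zero]
    simp only [mul_assoc, mul_left_comm, pow_two]
    ring
  have hC2 : HasDerivAt (fun s => ∑ l, a l s * b l s * (h l s)⁻¹ ^ 2)
      (R i i * ∑ l, R i l * R j l * (H l)⁻¹ ^ 2 + ∑ l, t l * R j l * (H l)⁻¹ ^ 2
        + ρ * R j i * (H i)⁻¹ ^ 2 + R i j * ∑ l, R i l ^ 2 * (H l)⁻¹ ^ 2
        + R i i * t j * (H i)⁻¹ ^ 2 + R i j * c * (H j)⁻¹ ^ 2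
        - 2 * H i * ∑ l, R i l ^ 2 * R j l * (H l)⁻¹ ^ 3) 0 := by
    refine (HasDerivAt.fun_sum fun k _ => ((ha k).mul (hb k)).mul ((hg k).pow 2)).congr_deriv ?_
    have e : ∀ k, ((R i i * R i k + t k + if k = i then ρ else 0) * R j k
          + R i k * (R i j * R i k + (if k = i then t j else 0) + if k = j then c else 0))
          * (H k)⁻¹ ^ 2
        + R i k * R j k * (2 * (H k)⁻¹ * -(R i k * H i * (H k)⁻¹ ^ 2))
        = R i i * (R i k * R j k * (H k)⁻¹ ^ 2) + t k * R j k * (H k)⁻¹ ^ 2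
          + (if k = i then ρ * R j i * (H i)⁻¹ ^ 2 else 0) + R i j * (R i k ^ 2 * (H k)⁻¹ ^ 2)
          + (if k = i then R i i * t j * (H i)⁻¹ ^ 2 else 0)
          + (if k = j then R i j * c * (H j)⁻¹ ^ 2 else 0)
          - 2 * H i * (R i k ^ 2 * R j k * (H k)⁻¹ ^ 3) := by
      intro k
      by_cases hk : k = i
      · subst hk; simp [hij]; ring
      · by_cases hk' : k = j
        · subst hk'; simp [hk]; ring
        · simp [hk, hk']; ring
    have e2 := Finset.sum_congr (rfl : (univ : Finset ι) = univ) fun k _ => e k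
    simp only [sum_add_distrib, sum_sub_distrib, ← mul_sum, sum_ite_eq', mem_univ, if_true] at e2
    rw [← e2, ← sum_add_distrib]
    refine sum_congr rfl fun k _ => ?_
    simp only [Pi.mul_apply, Pi.pow_apply, ha0, hb0, hh0]
    norm_num
  have hA : HasDerivAt (fun s => ∑ l, a l s * (h l s)⁻¹)
      (R i i * ∑ l, R i l * (H l)⁻¹ + ∑ l, t l * (H l)⁻¹ + ρ * (H i)⁻¹
        - H i * ∑ l, R i l ^ 2 * (H l)⁻¹ ^ 2) 0 := by
    refine (HasDerivAt.fun_sum fun k _ => (ha k).mul (hg k)).congr_deriv ?_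
    have e : ∀ k, (R i i * R i k + t k + if k = i then ρ else 0) * (h k 0)⁻¹
          + a k 0 * -(R i k * H i * (H k)⁻¹ ^ 2)
        = R i i * (R i k * (H k)⁻¹) + t k * (H k)⁻¹ + (if k = i then ρ * (H i)⁻¹ else 0)
          - H i * (R i k ^ 2 * (H k)⁻¹ ^ 2) := by
      intro k
      rw [ha0, hh0]
      split_ifs with hk
      · subst hk; ring
      · ring
    rw [sum_congr rfl fun k _ => e k]
    simp only [sum_add_distrib, sum_sub_distrib, ← mul_sum, sum_ite_eq', mem_univ, if_true]
  have hB : HasDerivAt (fun s => ∑ l, b l s * (h l s)⁻¹)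
      (R i j * ∑ l, R i l * (H l)⁻¹ + t j * (H i)⁻¹ + c * (H j)⁻¹
        - H i * ∑ l, R i l * R j l * (H l)⁻¹ ^ 2) 0 := by
    refine (HasDerivAt.fun_sum fun k _ => (hb k).mul (hg k)).congr_deriv ?_
    have e : ∀ k, (R i j * R i k + (if k = i then t j else 0) + if k = j then c else 0)
          * (h k 0)⁻¹ + b k 0 * -(R i k * H i * (H k)⁻¹ ^ 2)
        = R i j * (R i k * (H k)⁻¹) + (if k = i then t j * (H i)⁻¹ else 0)
          + (if k = j then c * (H j)⁻¹ else 0) - H i * (R i k * R j k * (H k)⁻¹ ^ 2) := by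
      intro k
      rw [hb0, hh0]
      by_cases hk : k = i
      · subst hk; simp [hij]; ring
      · by_cases hk' : k = j
        · subst hk'; simp [hk]; ring
        · simp [hk, hk']; ring
    rw [sum_congr rfl fun k _ => e k]
    simp only [sum_add_distrib, sum_sub_distrib, ← mul_sum, sum_ite_eq', mem_univ, if_true]
  have hi := hH i
  have hj := hH j
  have haj := ha j
  rw [if_neg hij.symm, add_zero] at haj
  have hd := (((((((hσ.fun_neg.fun_sub hC0).fun_mul (hh j)).fun_mul (hg i)).fun_add
    ((hσ.fun_mul (hh i)).fun_mul (hg j))).fun_sub ((haj.fun_pow 2).const_mul 12)).fun_sub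
    (((hh i).fun_mul (hh j)).fun_mul hC2)).fun_add ((haj.fun_mul (hh j)).fun_mul hA)).fun_add
    ((haj.fun_mul (hh i)).fun_mul hB)
  have hz := hd.unique ((hasDerivAt_const (0 : ℝ) (0 : ℝ)).congr_of_eventuallyEq hG)
  simp only [ha0, hb0, hh0, hσ0] at hz
  rw [← hz]
  field_simp
  ring

theorem deriv_sum_div_eq (R : ι → ι → ℝ) (Rsymm : ∀ a b, R a b = R b a) (H t s : ι → ℝ)
    (i : ι) (hH : ∀ k, H k ≠ 0) (ρ C : ℝ) (r : ι → ι → ℝ → ℝ) (h : ι → ℝ → ℝ)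
    (hh0 : ∀ k, h k 0 = H k) (hr0 : ∀ k l, r k l 0 = R k l)
    (hh : ∀ k, HasDerivAt (h k) (R i k * H i) 0)
    (hr : ∀ k l, HasDerivAt (r k l) (R i k * R i l + (if k = i then t l else 0)
      + (if l = i then t k else 0) + (if k = l then H i * (H k)⁻¹ * s k else 0)
      + if k = i then if l = i then ρ else 0 else 0) 0)
    (hC : ∀ᶠ x in nhds 0, (∑ k, ∑ l, r k l x / (h k x * h l x)) - 2 * ∑ k, r k k x / h k x ^ 2
      = C) :
    (∑ k, R i k * (H k)⁻¹) ^ 2 + 2 * (H i)⁻¹ * ∑ k, t k * (H k)⁻¹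
      - H i * ∑ k, s k * (H k)⁻¹ ^ 3 - ρ * (H i)⁻¹ ^ 2 - 4 * (t i) * (H i)⁻¹ ^ 2
      - 2 * H i * ∑ k, ∑ l, R k l * R l i * (H k)⁻¹ * (H l)⁻¹ ^ 2
      - 2 * ∑ k, R i k ^ 2 * (H k)⁻¹ ^ 2
      + 4 * H i * ∑ k, R k k * R i k * (H k)⁻¹ ^ 3 = 0 := by
  have hg : ∀ k, HasDerivAt (fun s => (h k s)⁻¹) (-(R i k * H i * (H k)⁻¹ ^ 2)) 0 := fun k => by
    refine ((hh k).fun_inv (by simpa [hh0] using hH k)).congr_deriv ?_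
    rw [hh0]; field_simp
  have hd1 : HasDerivAt (fun x => ∑ k, ∑ l, r k l x * ((h k x)⁻¹ * (h l x)⁻¹))
      ((∑ k, R i k * (H k)⁻¹) ^ 2 + 2 * (H i)⁻¹ * ∑ k, t k * (H k)⁻¹
        + H i * ∑ k, s k * (H k)⁻¹ ^ 3 + ρ * (H i)⁻¹ ^ 2
        - 2 * H i * ∑ k, ∑ l, R k l * R l i * (H k)⁻¹ * (H l)⁻¹ ^ 2) 0 := by
    refine (HasDerivAt.fun_sum fun k _ => HasDerivAt.fun_sum fun l _ =>
      (hr k l).fun_mul ((hg k).fun_mul (hg l))).congr_deriv ?_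
    have e : ∀ k l, (R i k * R i l + (if k = i then t l else 0)
          + (if l = i then t k else 0) + (if k = l then H i * (H k)⁻¹ * s k else 0)
          + if k = i then if l = i then ρ else 0 else 0) * ((h k 0)⁻¹ * (h l 0)⁻¹)
          + r k l 0 * (-(R i k * H i * (H k)⁻¹ ^ 2) * (h l 0)⁻¹
            + (h k 0)⁻¹ * -(R i l * H i * (H l)⁻¹ ^ 2))
        = (R i k * (H k)⁻¹) * (R i l * (H l)⁻¹)
          + (if k = i then (H i)⁻¹ * (t l * (H l)⁻¹) else 0)
          + (if l = i then (H i)⁻¹ * (t k * (H k)⁻¹) else 0)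
          + (if k = l then H i * (s k * (H k)⁻¹ ^ 3) else 0)
          + (if k = i then if l = i then ρ * (H i)⁻¹ ^ 2 else 0 else 0)
          - H i * (R l k * R k i * (H l)⁻¹ * (H k)⁻¹ ^ 2)
          - H i * (R k l * R l i * (H k)⁻¹ * (H l)⁻¹ ^ 2) := by
      intro k l
      rw [hr0, hh0, hh0, Rsymm l k, Rsymm k i, Rsymm l i]
      by_cases hk : k = i
      · subst hk
        by_cases hl : l = k
        · subst hl; simp; ring
        · simp [hl, Ne.symm hl]; ring
      · by_cases hl : l = i
        · subst hl; simp [hk]; ring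
        · by_cases hkl : k = l
          · subst hkl; simp [hk]; ring
          · simp [hk, hl, hkl]; ring
    rw [sum_congr rfl fun k _ => sum_congr rfl fun l _ => e k l]
    have hswap : ∑ k, ∑ l, R l k * R k i * (H l)⁻¹ * (H k)⁻¹ ^ 2
        = ∑ k, ∑ l, R k l * R l i * (H k)⁻¹ * (H l)⁻¹ ^ 2 := sum_comm
    have hi1 : ∑ k, ∑ l, (if k = i then (H i)⁻¹ * (t l * (H l)⁻¹) else 0)
        = (H i)⁻¹ * ∑ l, t l * (H l)⁻¹ := by
      rw [sum_comm]; simp [mul_sum]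
    have hi2 : ∑ k, ∑ l, (if k = i then if l = i then ρ * (H i)⁻¹ ^ 2 else 0 else 0)
        = ρ * (H i)⁻¹ ^ 2 := by
      rw [sum_comm]; simp
    simp only [sum_add_distrib, sum_sub_distrib]
    rw [hi1, hi2]
    simp only [← mul_sum, sum_ite_eq, sum_ite_eq', mem_univ, if_true]
    rw [hswap]
    simp only [← sum_mul]
    ring
  have hd2 : HasDerivAt (fun x => ∑ k, r k k x * (h k x)⁻¹ ^ 2)
      (∑ k, R i k ^ 2 * (H k)⁻¹ ^ 2 + H i * ∑ k, s k * (H k)⁻¹ ^ 3 + ρ * (H i)⁻¹ ^ 2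
        + 2 * (t i) * (H i)⁻¹ ^ 2
        - 2 * H i * ∑ k, R k k * R i k * (H k)⁻¹ ^ 3) 0 := by
    refine (HasDerivAt.fun_sum fun k _ =>
      (hr k k).fun_mul ((hg k).fun_pow 2)).congr_deriv ?_
    have e : ∀ k, (R i k * R i k + (if k = i then t k else 0)
          + (if k = i then t k else 0) + (if k = k then H i * (H k)⁻¹ * s k else 0)
          + if k = i then if k = i then ρ else 0 else 0) * (h k 0)⁻¹ ^ 2
          + r k k 0 * (((2 : ℕ) : ℝ) * (h k 0)⁻¹ ^ (2 - 1) * -(R i k * H i * (H k)⁻¹ ^ 2))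
        = R i k ^ 2 * (H k)⁻¹ ^ 2 + H i * (s k * (H k)⁻¹ ^ 3)
          + (if k = i then ρ * (H i)⁻¹ ^ 2 + 2 * (t i) * (H i)⁻¹ ^ 2 else 0)
          - 2 * H i * (R k k * R i k * (H k)⁻¹ ^ 3) := by
      intro k
      rw [hr0, hh0]
      by_cases hk : k = i
      · subst hk; simp; ring
      · simp [hk]; ring
    rw [sum_congr rfl fun k _ => e k]
    simp only [sum_add_distrib, sum_sub_distrib, ← mul_sum, sum_ite_eq', mem_univ, if_true]
    ring
  have hfun : ∀ᶠ x in nhds (0 : ℝ), (∑ k, ∑ l, r k l x * ((h k x)⁻¹ * (h l x)⁻¹))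
      - 2 * ∑ k, r k k x * (h k x)⁻¹ ^ 2 = C := by
    filter_upwards [hC] with x hx
    simpa only [div_eq_mul_inv, mul_inv, inv_pow] using hx
  have hz := (hd1.fun_sub (hd2.const_mul 2)).unique
    ((hasDerivAt_const (0 : ℝ) C).congr_of_eventuallyEq hfun)
  rw [← hz]
  ring

end CalculusRelations

section PointwiseIdentity

variable {ι : Type*} [Fintype ι] [DecidableEq ι]

theorem omega_identity_of_relations (R : ι → ι → ℝ) (Rsymm : ∀ a b, R a b = R b a)
    (H t : ι → ℝ) (i j : ι) (hij : j ≠ i) (hH : ∀ k, H k ≠ 0)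
    (hstring : ∀ k, ∑ l, R k l * H l = 0) (t_self : t i = 0) (ρ c S dS Om : ℝ)
    (hrel : ∀ k, k ≠ i → t k * H k * (H i)⁻¹ + (-t k - ∑ l, R i l * R k l) * H i * (H k)⁻¹
      - 12 * R i k ^ 2 - H i * H k * ∑ l, R i l * R k l * (H l)⁻¹ ^ 2
      + R i k * H k * ∑ l, R i l * (H l)⁻¹ + R i k * H i * ∑ l, R k l * (H l)⁻¹ = 0)
    (hρ : ρ = -∑ l, R i l ^ 2 - (H i)⁻¹ * ∑ k, t k * H k)
    (hc : c = H i * (H j)⁻¹ * S) (hS : S = -t j - ∑ l, R i l * R j l)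
    (hdS : dS = R i i * S - R i j * c - Om)
    (hD : (∑ k, R i k * (H k)⁻¹) ^ 2 + 2 * (H i)⁻¹ * ∑ k, t k * (H k)⁻¹
      - H i * (-∑ k, t k * (H k)⁻¹ ^ 3 - ∑ k, ∑ l, R i l * R k l * (H k)⁻¹ ^ 3
        + (H i)⁻¹ ^ 3 * ∑ l, R i l ^ 2) - ρ * (H i)⁻¹ ^ 2 - 4 * (t i) * (H i)⁻¹ ^ 2
      - 2 * H i * ∑ k, ∑ l, R k l * R l i * (H k)⁻¹ * (H l)⁻¹ ^ 2
      - 2 * ∑ k, R i k ^ 2 * (H k)⁻¹ ^ 2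
      + 4 * H i * ∑ k, R k k * R i k * (H k)⁻¹ ^ 3 = 0)
    (hdG : -(dS + (R i i * ∑ l, R i l * R j l + ∑ l, t l * R j l + ρ * R j i
        + R i j * ∑ l, R i l ^ 2 + R i i * t j + R i j * c)) * H j * (H i)⁻¹
      + (-S - ∑ l, R i l * R j l) * (R i j - H j * (R i i * (H i)⁻¹))
      + dS * H i * (H j)⁻¹ + S * (R i i * H i * (H j)⁻¹ - H i * (R i j * H i * (H j)⁻¹ ^ 2))
      - 24 * R i j * (R i i * R i j + t j)
      - (R i i * H i * H j + H i * (R i j * H i)) * ∑ l, R i l * R j l * (H l)⁻¹ ^ 2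
      - H i * H j * (R i i * ∑ l, R i l * R j l * (H l)⁻¹ ^ 2 + ∑ l, t l * R j l * (H l)⁻¹ ^ 2
        + ρ * R j i * (H i)⁻¹ ^ 2 + R i j * ∑ l, R i l ^ 2 * (H l)⁻¹ ^ 2
        + R i i * t j * (H i)⁻¹ ^ 2 + R i j * c * (H j)⁻¹ ^ 2
        - 2 * H i * ∑ l, R i l ^ 2 * R j l * (H l)⁻¹ ^ 3)
      + ((R i i * R i j + t j) * H j + R i j * (R i j * H i)) * ∑ l, R i l * (H l)⁻¹
      + R i j * H j * (R i i * ∑ l, R i l * (H l)⁻¹ + ∑ l, t l * (H l)⁻¹ + ρ * (H i)⁻¹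
        - H i * ∑ l, R i l ^ 2 * (H l)⁻¹ ^ 2)
      + ((R i i * R i j + t j) * H i + R i j * (R i i * H i)) * ∑ l, R j l * (H l)⁻¹
      + R i j * H i * (R i j * ∑ l, R i l * (H l)⁻¹ + t j * (H i)⁻¹ + c * (H j)⁻¹
        - H i * ∑ l, R i l * R j l * (H l)⁻¹ ^ 2) = 0) :
    0 = Om * (H i / H j - H j / H i)
        + t j * (20 * R i j + 4 * R i i * H j / H i
            - ∑ k, (R i k * H j / H k + R j k * H i / H k))
        + 2 * ∑ k, t k * R j k * H j / H i
        + 24 * R i i ^ 2 * R i j * H j / H i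
        + 24 * R i j ^ 3 * H i / H j
        - 12 * ∑ k, R i k ^ 2 * R j k * H j / H k
        + 4 * ∑ k, R i j * R i k * R j k * H i ^ 2 / H k ^ 2
        - 4 * ∑ k, R i j ^ 2 * R i k * H i / H k
        - 4 * ∑ k, R i i * R i j * R i k * H j / H k
        - 3 * ∑ k, R i j * R i k ^ 2 * H i * H j / H k ^ 2
        - 4 * ∑ k, R i k ^ 2 * R i j * H j / H i
        + 2 * ∑ k, R i j * R k k * R i k * H i ^ 2 * H j / H k ^ 3
        - 2 * ∑ k, R i j ^ 2 * R j k * H i ^ 2 / (H k * H j)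
        - 2 * ∑ k, R i k ^ 2 * R j k * H i ^ 2 * H j / H k ^ 3
        - ∑ k, ∑ l, R i j * R k l * R l i * H i ^ 2 * H j / (H k * H l ^ 2)
        + ∑ k, ∑ l, R i j * R i k * R l i * H i * H j / (H k * H l)
        - ∑ k, ∑ l, R k l * R j l * R i k * H i * H j / H l ^ 2
        - ∑ k, ∑ l, R i l * R k l * R j k * H i * H j / H l ^ 2
        + ∑ k, ∑ l, R i k * R i l * R j k * H j / H l
        + ∑ k, ∑ l, R i k * R k l * R j k * H i * H j / (H k * H l) := by
  have hi := hH i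
  have hj := hH j
  have K1 := sum_relation_weighted R H t (fun k => R j k * (H k)⁻¹) i t_self hrel hi
  have K2 := sum_relation_weighted R H t (fun k => (H k)⁻¹ ^ 2) i t_self hrel hi
  have K3 := sum_relation_weighted R H t (fun _ => 1) i t_self hrel hi
  have hrj := hrel j hij
  -- the sums occurring in the weighted relations
  have p1 : ∑ k, t k * H k * (R j k * (H k)⁻¹) = ∑ k, t k * R j k :=
    sum_congr rfl fun k _ => by have := hH k; field_simp
  have p2 : ∑ k, t k * (H k)⁻¹ * (R j k * (H k)⁻¹) = ∑ k, t k * R j k * (H k)⁻¹ ^ 2 :=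
    sum_congr rfl fun k _ => by ring
  have p3 : ∑ k, ∑ l, R i l * R k l * (H k)⁻¹ * (R j k * (H k)⁻¹)
      = ∑ k, ∑ l, R k l * R j l * R i k * (H l)⁻¹ ^ 2 := by
    rw [sum_comm]
    exact sum_congr rfl fun k _ => sum_congr rfl fun l _ => by rw [Rsymm k l]; ring
  have p4 : ∑ k, R i k ^ 2 * (R j k * (H k)⁻¹) = ∑ k, R i k ^ 2 * R j k * (H k)⁻¹ :=
    sum_congr rfl fun k _ => by ring
  have p5 : ∑ k, ∑ l, R i l * R k l * (H l)⁻¹ ^ 2 * (H k * (R j k * (H k)⁻¹))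
      = ∑ k, ∑ l, R i l * R k l * R j k * (H l)⁻¹ ^ 2 :=
    sum_congr rfl fun k _ => sum_congr rfl fun l _ => by have := hH k; field_simp
  have p6 : ∑ k, R i k * H k * (R j k * (H k)⁻¹) = ∑ k, R i k * R j k :=
    sum_congr rfl fun k _ => by have := hH k; field_simp
  have p7 : ∑ k, ∑ l, R i k * R k l * (H l)⁻¹ * (R j k * (H k)⁻¹)
      = ∑ k, ∑ l, R i k * R k l * R j k * ((H k)⁻¹ * (H l)⁻¹) :=
    sum_congr rfl fun k _ => sum_congr rfl fun l _ => by ring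
  have q1 : ∑ k, t k * H k * (H k)⁻¹ ^ 2 = ∑ k, t k * (H k)⁻¹ :=
    sum_congr rfl fun k _ => by have := hH k; field_simp
  have q2 : ∑ k, t k * (H k)⁻¹ * (H k)⁻¹ ^ 2 = ∑ k, t k * (H k)⁻¹ ^ 3 :=
    sum_congr rfl fun k _ => by ring
  have q3 : ∑ k, ∑ l, R i l * R k l * (H k)⁻¹ * (H k)⁻¹ ^ 2
      = ∑ k, ∑ l, R i l * R k l * (H k)⁻¹ ^ 3 :=
    sum_congr rfl fun k _ => sum_congr rfl fun l _ => by ring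
  have q5 : ∑ k, ∑ l, R i l * R k l * (H l)⁻¹ ^ 2 * (H k * (H k)⁻¹ ^ 2)
      = ∑ k, ∑ l, R k l * R l i * (H k)⁻¹ * (H l)⁻¹ ^ 2 :=
    sum_congr rfl fun k _ => sum_congr rfl fun l _ => by
      have := hH k; rw [Rsymm i l]; field_simp
  have q6 : ∑ k, R i k * H k * (H k)⁻¹ ^ 2 = ∑ k, R i k * (H k)⁻¹ :=
    sum_congr rfl fun k _ => by have := hH k; field_simp
  have q7 : ∑ k, ∑ l, R i k * R k l * (H l)⁻¹ * (H k)⁻¹ ^ 2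
      = ∑ k, ∑ l, R k l * R l i * (H k)⁻¹ * (H l)⁻¹ ^ 2 := by
    rw [sum_comm]
    exact sum_congr rfl fun k _ => sum_congr rfl fun l _ => by
      rw [Rsymm l i, Rsymm k l]; ring
  have s3 : ∑ k, ∑ l, R i l * R k l * (H k)⁻¹ = ∑ k, ∑ l, R i k * R k l * (H l)⁻¹ := by
    rw [sum_comm]
    exact sum_congr rfl fun k _ => sum_congr rfl fun l _ => by rw [Rsymm k l]
  have s5 : ∑ k, ∑ l, R i l * R k l * (H l)⁻¹ ^ 2 * H k = 0 := by
    rw [sum_comm]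
    refine sum_eq_zero fun l _ => ?_
    have e : ∀ k, R i l * R k l * (H l)⁻¹ ^ 2 * H k
        = R i l * (H l)⁻¹ ^ 2 * (R l k * H k) := fun k => by rw [Rsymm k l]; ring
    rw [sum_congr rfl fun k _ => e k, ← mul_sum, hstring, mul_zero]
  beta_reduce at K1 K2 K3
  rw [p1, p2, p3, p4, p5, p6, p7] at K1
  rw [q1, q2, q3, q5, q6, q7] at K2
  simp only [mul_one] at K3
  rw [s3, s5, hstring] at K3
  -- the sums occurring in the conclusion
  have c1 : ∑ k, (R i k * H j / H k + R j k * H i / H k)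
      = H j * ∑ k, R i k * (H k)⁻¹ + H i * ∑ k, R j k * (H k)⁻¹ := by
    rw [mul_sum, mul_sum, ← sum_add_distrib]; exact sum_congr rfl fun k _ => by ring
  have c2 : ∑ k, t k * R j k * H j / H i = H j / H i * ∑ k, t k * R j k := by
    rw [mul_sum]; exact sum_congr rfl fun k _ => by ring
  have c3 : ∑ k, R i k ^ 2 * R j k * H j / H k = H j * ∑ k, R i k ^ 2 * R j k * (H k)⁻¹ := by
    rw [mul_sum]; exact sum_congr rfl fun k _ => by ring
  have c4 : ∑ k, R i j * R i k * R j k * H i ^ 2 / H k ^ 2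
      = R i j * H i ^ 2 * ∑ k, R i k * R j k * (H k)⁻¹ ^ 2 := by
    rw [mul_sum]; exact sum_congr rfl fun k _ => by ring
  have c5 : ∑ k, R i j ^ 2 * R i k * H i / H k = R i j ^ 2 * H i * ∑ k, R i k * (H k)⁻¹ := by
    rw [mul_sum]; exact sum_congr rfl fun k _ => by ring
  have c6 : ∑ k, R i i * R i j * R i k * H j / H k
      = R i i * R i j * H j * ∑ k, R i k * (H k)⁻¹ := by
    rw [mul_sum]; exact sum_congr rfl fun k _ => by ring
  have c7 : ∑ k, R i j * R i k ^ 2 * H i * H j / H k ^ 2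
      = R i j * H i * H j * ∑ k, R i k ^ 2 * (H k)⁻¹ ^ 2 := by
    rw [mul_sum]; exact sum_congr rfl fun k _ => by ring
  have c8 : ∑ k, R i k ^ 2 * R i j * H j / H i = R i j * H j / H i * ∑ k, R i k ^ 2 := by
    rw [mul_sum]; exact sum_congr rfl fun k _ => by ring
  have c9 : ∑ k, R i j * R k k * R i k * H i ^ 2 * H j / H k ^ 3
      = R i j * H i ^ 2 * H j * ∑ k, R k k * R i k * (H k)⁻¹ ^ 3 := by
    rw [mul_sum]; exact sum_congr rfl fun k _ => by ring
  have c10 : ∑ k, R i j ^ 2 * R j k * H i ^ 2 / (H k * H j)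
      = R i j ^ 2 * H i ^ 2 / H j * ∑ k, R j k * (H k)⁻¹ := by
    rw [mul_sum]; exact sum_congr rfl fun k _ => by ring
  have c11 : ∑ k, R i k ^ 2 * R j k * H i ^ 2 * H j / H k ^ 3
      = H i ^ 2 * H j * ∑ k, R i k ^ 2 * R j k * (H k)⁻¹ ^ 3 := by
    rw [mul_sum]; exact sum_congr rfl fun k _ => by ring
  have c12 : ∑ k, ∑ l, R i j * R k l * R l i * H i ^ 2 * H j / (H k * H l ^ 2)
      = R i j * H i ^ 2 * H j * ∑ k, ∑ l, R k l * R l i * (H k)⁻¹ * (H l)⁻¹ ^ 2 := by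
    simp only [mul_sum]
    exact sum_congr rfl fun k _ => sum_congr rfl fun l _ => by ring
  have c13 : ∑ k, ∑ l, R i j * R i k * R l i * H i * H j / (H k * H l)
      = R i j * H i * H j * ((∑ k, R i k * (H k)⁻¹) * ∑ k, R i k * (H k)⁻¹) := by
    rw [sum_mul_sum]
    simp only [mul_sum]
    exact sum_congr rfl fun k _ => sum_congr rfl fun l _ => by rw [Rsymm l i]; ring
  have c14 : ∑ k, ∑ l, R k l * R j l * R i k * H i * H j / H l ^ 2
      = H i * H j * ∑ k, ∑ l, R k l * R j l * R i k * (H l)⁻¹ ^ 2 := by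
    simp only [mul_sum]
    exact sum_congr rfl fun k _ => sum_congr rfl fun l _ => by ring
  have c15 : ∑ k, ∑ l, R i l * R k l * R j k * H i * H j / H l ^ 2
      = H i * H j * ∑ k, ∑ l, R i l * R k l * R j k * (H l)⁻¹ ^ 2 := by
    simp only [mul_sum]
    exact sum_congr rfl fun k _ => sum_congr rfl fun l _ => by ring
  have c16 : ∑ k, ∑ l, R i k * R i l * R j k * H j / H l
      = H j * ((∑ k, R i k * R j k) * ∑ l, R i l * (H l)⁻¹) := by
    rw [sum_mul_sum]
    simp only [mul_sum]
    exact sum_congr rfl fun k _ => sum_congr rfl fun l _ => by ring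
  have c17 : ∑ k, ∑ l, R i k * R k l * R j k * H i * H j / (H k * H l)
      = H i * H j * ∑ k, ∑ l, R i k * R k l * R j k * ((H k)⁻¹ * (H l)⁻¹) := by
    simp only [mul_sum]
    exact sum_congr rfl fun k _ => sum_congr rfl fun l _ => by ring
  rw [c1, c2, c3, c4, c5, c6, c7, c8, c9, c10, c11, c12, c13, c14, c15, c16, c17]
  clear p1 p2 p3 p4 p5 p6 p7 q1 q2 q3 q5 q6 q7 s3 s5
  clear c1 c2 c3 c4 c5 c6 c7 c8 c9 c10 c11 c12 c13 c14 c15 c16 c17 hrel hstring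
  rw [t_self] at hD
  rw [Rsymm j i] at hdG K1
  subst hρ hdS hc hS
  generalize ∑ k, ∑ l, R i k * R k l * R j k * ((H k)⁻¹ * (H l)⁻¹) = Y4 at *
  generalize ∑ k, ∑ l, R i l * R k l * R j k * (H l)⁻¹ ^ 2 = Y2 at *
  generalize ∑ k, ∑ l, R k l * R j l * R i k * (H l)⁻¹ ^ 2 = Y1 at *
  generalize ∑ k, ∑ l, R k l * R l i * (H k)⁻¹ * (H l)⁻¹ ^ 2 = X1 at *
  generalize ∑ k, ∑ l, R i l * R k l * (H k)⁻¹ ^ 3 = X2 at *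
  generalize ∑ k, ∑ l, R i k * R k l * (H l)⁻¹ = X3 at *
  generalize ∑ k, R i k ^ 2 * R j k * (H k)⁻¹ ^ 3 = m3 at *
  generalize ∑ k, R i k ^ 2 * R j k * (H k)⁻¹ = m1 at *
  generalize ∑ k, R k k * R i k * (H k)⁻¹ ^ 3 = n3 at *
  generalize ∑ k, R i k ^ 2 * (H k)⁻¹ ^ 2 = a22 at *
  generalize ∑ k, R i k ^ 2 = a2 at *
  generalize ∑ k, R i k * R j k * (H k)⁻¹ ^ 2 = c2 at *
  generalize ∑ k, R i k * R j k = c0 at *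
  generalize ∑ k, R i k * (H k)⁻¹ = a1 at *
  generalize ∑ k, R j k * (H k)⁻¹ = b1 at *
  generalize ∑ k, t k * R j k * (H k)⁻¹ ^ 2 = Tj2 at *
  generalize ∑ k, t k * R j k = Tj0 at *
  generalize ∑ k, t k * (H k)⁻¹ ^ 3 = T3 at *
  generalize ∑ k, t k * (H k)⁻¹ = T1 at *
  generalize ∑ k, t k * H k = Th at *
  linear_combination (norm := skip) hdG - 1 / 2 * R i j * H i * H j * hD
    - (-2 * R i j * H i * (H j)⁻¹ + 2 * R i i) * hrj - H j * K1
    - 1 / 2 * R i j * H i * H j * K2 - 1 / 2 * R i j * H j * (H i)⁻¹ * K3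
  field_simp
  ring

end PointwiseIdentity

theorem hasDerivAt_line_of_contDiffOn {N : ℕ} {U : Set (Fin N → ℝ)} (hU : IsOpen U)
    {f : (Fin N → ℝ) → ℝ} (hf : ContDiffOn ℝ (⊤ : ℕ∞) f U) {x : Fin N → ℝ} (hx : x ∈ U)
    (i : Fin N) :
    HasDerivAt (fun s : ℝ => f (x + s • Pi.single i 1)) (pd f i x) 0 := by
  have hfx : HasFDerivAt f (fderiv ℝ f x) (x + (0 : ℝ) • Pi.single i 1) := by
    rw [zero_smul, add_zero]
    exact ((hf.contDiffAt (hU.mem_nhds hx)).differentiableAt (by simp)).hasFDerivAt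
  have hl : HasDerivAt (fun s : ℝ => x + s • (Pi.single i 1 : Fin N → ℝ)) (Pi.single i 1) 0 := by
    simpa using ((hasDerivAt_id (0 : ℝ)).smul_const (Pi.single i 1 : Fin N → ℝ)).const_add x
  exact hfx.comp_hasDerivAt 0 hl

theorem Omega_tilde_identity
    (N : ℕ) (hN : 2 ≤ N)
    (U : Set (Fin N → ℝ)) (hUopen : IsOpen U) (hUconn : IsConnected U)
    (hdist : ∀ x ∈ U, ∀ i j : Fin N, i ≠ j → x i ≠ x j)
    (h : Fin N → (Fin N → ℝ) → ℝ)
    (hsmooth : ∀ i, ContDiffOn ℝ (⊤ : ℕ∞) (h i) U)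
    (hne : ∀ i, ∀ x ∈ U, h i x ≠ 0)
    (r : Fin N → Fin N → (Fin N → ℝ) → ℝ)
    (rsmooth : ∀ i j, ContDiffOn ℝ (⊤ : ℕ∞) (r i j) U)
    (rsymm : ∀ i j, r i j = r j i)
    (hb : ∀ i j, ∀ x ∈ U, pd (h i) j x = r i j x * h j x)
    (hstring : ∀ i, ∀ x ∈ U, ∑ j, r i j x * h j x = 0)
    (v : Fin N → Fin N → (Fin N → ℝ) → ℝ)
    (hv : ∀ i j, ∀ x ∈ U, v i j x = (x j - x i) * r i j x)
    (θ : Fin N → Fin N → (Fin N → ℝ) → ℝ)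
    (hθ : ∀ i j, i ≠ j → ∀ x ∈ U,
      θ i j x = (r i j x + ∑ k, r i k x * v j k x) / (x j - x i))
    (Ω : Fin N → Fin N → (Fin N → ℝ) → ℝ)
    (hΩ : ∀ i j, i ≠ j → ∀ x ∈ U,
      Ω i j x = (θ i j x - θ j i x + ∑ k, ∑ l, r i l x * r j k x * v k l x) / (x j - x i))
    (hc : ∀ i j k : Fin N, i ≠ j → j ≠ k → i ≠ k → ∀ x ∈ U,
      pd (r i j) k x = r i k x * r j k x)
    (hd : ∀ i j, i ≠ j → ∀ x ∈ U, pd (r i j) i x = r i i x * r i j x + θ i j x)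
    (he : ∀ i k, k ≠ i → ∀ x ∈ U,
      pd (r i i) k x = (r i k x) ^ 2 + (h k x / h i x) * θ i k x)
    (hf : ∀ i, ∀ x ∈ U, pd (r i i) i x =
      (r i i x) ^ 2 - 2 * ∑ l, (r i l x) ^ 2
        + ∑ p ∈ univ.filter (fun p => p ≠ i), (h p x / h i x) * θ p i x)
    (hC1 : ∃ c : ℝ, ∀ x ∈ U,
      (∑ i, ∑ j, r i j x / (h i x * h j x)) - 2 * ∑ i, r i i x / (h i x) ^ 2 = c)
    (hG1 : ∀ i, ∀ x ∈ U,
      ∑ j, r i j x * v i j x = -(1/12) * ∑ j, r i j x * h i x / h j x)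
    (hG2 : ∀ i j, i ≠ j → ∀ x ∈ U,
      θ i j x * h j x / h i x + θ j i x * h i x / h j x
        = 12 * (r i j x) ^ 2
          + ∑ l, (r i l x * r j l x * h i x * h j x / (h l x) ^ 2
              - r i j x * r i l x * h j x / h l x - r i j x * r j l x * h i x / h l x))
    :
    ∀ i j : Fin N, i ≠ j → ∀ x ∈ U,
      0 = Ω i j x * (h i x / h j x - h j x / h i x)
        + θ i j x * (20 * r i j x + 4 * r i i x * h j x / h i x
            - ∑ k, (r i k x * h j x / h k x + r j k x * h i x / h k x))
        + 2 * ∑ k ∈ univ.filter (fun k => k ≠ i), θ i k x * r j k x * h j x / h i x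
        + 24 * (r i i x) ^ 2 * r i j x * h j x / h i x
        + 24 * (r i j x) ^ 3 * h i x / h j x
        - 12 * ∑ k, (r i k x) ^ 2 * r j k x * h j x / h k x
        + 4 * ∑ k, r i j x * r i k x * r j k x * (h i x) ^ 2 / (h k x) ^ 2
        - 4 * ∑ k, (r i j x) ^ 2 * r i k x * h i x / h k x
        - 4 * ∑ k, r i i x * r i j x * r i k x * h j x / h k x
        - 3 * ∑ k, r i j x * (r i k x) ^ 2 * h i x * h j x / (h k x) ^ 2
        - 4 * ∑ k, (r i k x) ^ 2 * r i j x * h j x / h i x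
        + 2 * ∑ k, r i j x * r k k x * r i k x * (h i x) ^ 2 * h j x / (h k x) ^ 3
        - 2 * ∑ k, (r i j x) ^ 2 * r j k x * (h i x) ^ 2 / (h k x * h j x)
        - 2 * ∑ k, (r i k x) ^ 2 * r j k x * (h i x) ^ 2 * h j x / (h k x) ^ 3
        - ∑ k, ∑ l, r i j x * r k l x * r l i x * (h i x) ^ 2 * h j x / (h k x * (h l x) ^ 2)
        + ∑ k, ∑ l, r i j x * r i k x * r l i x * h i x * h j x / (h k x * h l x)
        - ∑ k, ∑ l, r k l x * r j l x * r i k x * h i x * h j x / (h l x) ^ 2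
        - ∑ k, ∑ l, r i l x * r k l x * r j k x * h i x * h j x / (h l x) ^ 2
        + ∑ k, ∑ l, r i k x * r i l x * r j k x * h j x / h l x
        + ∑ k, ∑ l, r i k x * r k l x * r j k x * h i x * h j x / (h k x * h l x) := by
  intro i j hij x hx
  have hline : ∀ᶠ s : ℝ in nhds 0, x + s • (Pi.single i 1 : Fin N → ℝ) ∈ U := by
    have hcont : Continuous fun s : ℝ => x + s • (Pi.single i 1 : Fin N → ℝ) := by fun_prop
    exact hcont.continuousAt.eventually (hUopen.mem_nhds (by simpa using hx))
  have hline0 : x + (0 : ℝ) • (Pi.single i 1 : Fin N → ℝ) = x := by simp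
  have rsymm' : ∀ a b y, r a b y = r b a y := fun a b y => by rw [rsymm a b]
  have hθ' : ∀ a b, a ≠ b → ∀ y ∈ U, θ a b y
      = (r a b y + ∑ k, r a k y * ((y k - y b) * r b k y)) / (y b - y a) := by
    intro a b hab y hy
    rw [hθ a b hab y hy, sum_congr rfl fun k _ => by rw [hv b k y hy]]
  have hswap : ∀ k, k ≠ i → ∀ y ∈ U, θ i k y + θ k i y = -∑ l, r i l y * r k l y := by
    intro k hk y hy
    rw [hθ' i k hk.symm y hy, hθ' k i hk y hy]
    exact theta_add_theta_swap (fun a b => r a b y) (fun a b => rsymm' a b y) y i k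
      (hdist y hy i k hk.symm)
  have hG : ∀ k, k ≠ i → ∀ y ∈ U, (-θ k i y - ∑ l, r i l y * r k l y) * h k y * (h i y)⁻¹
      + θ k i y * h i y * (h k y)⁻¹ - 12 * r i k y ^ 2
      - h i y * h k y * ∑ l, r i l y * r k l y * (h l y)⁻¹ ^ 2
      + r i k y * h k y * ∑ l, r i l y * (h l y)⁻¹
      + r i k y * h i y * ∑ l, r k l y * (h l y)⁻¹ = 0 := by
    intro k hk y hy
    have e : ∑ l, (r i l y * r k l y * h i y * h k y / h l y ^ 2
          - r i k y * r i l y * h k y / h l y - r i k y * r k l y * h i y / h l y)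
        = h i y * h k y * ∑ l, r i l y * r k l y * (h l y)⁻¹ ^ 2
          - r i k y * h k y * ∑ l, r i l y * (h l y)⁻¹
          - r i k y * h i y * ∑ l, r k l y * (h l y)⁻¹ := by
      simp only [mul_sum, ← sum_sub_distrib]
      exact sum_congr rfl fun l _ => by ring
    have h2 := hG2 i k hk.symm y hy
    rw [e] at h2
    have h3 := hswap k hk y hy
    linear_combination h2 - h k y * (h i y)⁻¹ * h3
  set t : Fin N → ℝ := fun k => if k = i then 0 else θ i k x
  set σ : Fin N → ℝ := fun k => if k = i then 0 else θ k i x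
  set ρ : ℝ := pd (r i i) i x - r i i x ^ 2 with hρ
  have t_self : t i = 0 := if_pos rfl
  have σ_self : σ i = 0 := if_pos rfl
  have t_ne : ∀ k, k ≠ i → t k = θ i k x := fun k hk => if_neg hk
  have σ_ne : ∀ k, k ≠ i → σ k = θ k i x := fun k hk => if_neg hk
  have hσt : ∀ k, σ k = -t k - ∑ l, r i l x * r k l x
      + if k = i then ∑ l, r i l x ^ 2 else 0 := by
    intro k
    by_cases hk : k = i
    · subst hk; rw [t_self, σ_self, if_pos rfl]; simp only [pow_two]; ring
    · rw [t_ne k hk, σ_ne k hk, if_neg hk]; linear_combination hswap k hk x hx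
  have hhd : ∀ k, HasDerivAt (fun s : ℝ => h k (x + s • Pi.single i 1)) (r i k x * h i x) 0 :=
    fun k => (hasDerivAt_line_of_contDiffOn hUopen (hsmooth k) hx i).congr_deriv
      (by rw [hb k i x hx, rsymm' k i])
  have hrd : ∀ k l, HasDerivAt (fun s : ℝ => r k l (x + s • Pi.single i 1))
      (r i k x * r i l x + (if k = i then t l else 0)
      + (if l = i then t k else 0) + (if k = l then h i x * (h k x)⁻¹ * σ k else 0)
      + if k = i then if l = i then ρ else 0 else 0) 0 := by
    intro k l
    refine (hasDerivAt_line_of_contDiffOn hUopen (rsmooth k l) hx i).congr_deriv ?_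
    by_cases hk : k = i
    · subst hk
      by_cases hl : l = k
      · subst hl; simp only [if_true, t_self, σ_self, hρ]; ring
      · rw [hd k l (Ne.symm hl) x hx]; simp [hl, Ne.symm hl, t_ne l hl]
    · by_cases hl : l = i
      · subst hl; rw [rsymm k l, hd l k (Ne.symm hk) x hx]; simp [hk, t_ne k hk]; ring
      · by_cases hkl : k = l
        · subst hkl
          rw [he k i (Ne.symm hk) x hx, rsymm' k i]; simp [hk, σ_ne k hk]; ring
        · rw [hc k l i hkl hl hk x hx, rsymm' k i, rsymm' l i]; simp [hk, hl, hkl]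
  have had : ∀ k, HasDerivAt (fun s : ℝ => r i k (x + s • Pi.single i 1))
      (r i i x * r i k x + t k + if k = i then ρ else 0) 0 := by
    refine fun k => (hrd i k).congr_deriv ?_
    by_cases hk : k = i
    · subst hk; simp [t_self, σ_self]
    · simp [hk, Ne.symm hk]
  have hbd : ∀ k, HasDerivAt (fun s : ℝ => r j k (x + s • Pi.single i 1))
      (r i j x * r i k x + (if k = i then t j else 0)
        + if k = j then h i x * (h j x)⁻¹ * θ j i x else 0) 0 := by
    refine fun k => (hrd j k).congr_deriv ?_
    rw [σ_ne j hij.symm]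
    simp [hij.symm, eq_comm (a := j) (b := k)]
  have hud : ∀ k, HasDerivAt (fun s : ℝ => (x + s • (Pi.single i 1 : Fin N → ℝ)) k)
      (if k = i then 1 else 0) 0 := by
    intro k
    have := (((hasDerivAt_id (0 : ℝ)).mul_const
      ((Pi.single i 1 : Fin N → ℝ) k)).const_add (x k))
    simpa [Pi.single_apply] using this
  have hρ' : ρ = -∑ l, r i l x ^ 2 - (h i x)⁻¹ * ∑ k, t k * h k x := by
    have e1 : ∑ p ∈ univ.filter (fun p => p ≠ i), (h p x / h i x) * θ p i x
        = (h i x)⁻¹ * ∑ p, h p x * σ p := by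
      rw [sum_filter, mul_sum]
      refine sum_congr rfl fun p _ => ?_
      by_cases hp : p = i
      · simp [hp, σ_self]
      · rw [if_pos hp, σ_ne p hp]; ring
    have e2 : ∑ p, h p x * σ p = -∑ k, t k * h k x + h i x * ∑ l, r i l x ^ 2 := by
      have e3 : ∑ k, ∑ l, h k x * (r i l x * r k l x) = 0 := by
        rw [sum_comm]
        refine sum_eq_zero fun l _ => ?_
        rw [sum_congr rfl fun k _ => show h k x * (r i l x * r k l x)
          = r i l x * (r l k x * h k x) by rw [rsymm' k l]; ring]
        rw [← mul_sum, hstring l x hx, mul_zero]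
      have e4 : ∀ p, h p x * σ p = -(t p * h p x) - ∑ l, h p x * (r i l x * r p l x)
          + if p = i then h i x * ∑ l, r i l x ^ 2 else 0 := by
        intro p
        rw [hσt p, ← mul_sum]
        by_cases hp : p = i
        · subst hp; rw [if_pos rfl, if_pos rfl]; ring
        · rw [if_neg hp, if_neg hp]; ring
      rw [sum_congr rfl fun p _ => e4 p, sum_add_distrib, sum_sub_distrib, e3,
        sum_ite_eq' univ i, if_pos (mem_univ i), sum_neg_distrib, sub_zero]
    rw [hρ, hf i x hx, e1, e2]
    have := hne i x hx
    field_simp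
    ring
  have hσ3 : ∑ k, σ k * (h k x)⁻¹ ^ 3 = -∑ k, t k * (h k x)⁻¹ ^ 3
      - ∑ k, ∑ l, r i l x * r k l x * (h k x)⁻¹ ^ 3 + (h i x)⁻¹ ^ 3 * ∑ l, r i l x ^ 2 := by
    have e4 : ∀ p, σ p * (h p x)⁻¹ ^ 3 = -(t p * (h p x)⁻¹ ^ 3)
        - ∑ l, r i l x * r p l x * (h p x)⁻¹ ^ 3
        + if p = i then (h i x)⁻¹ ^ 3 * ∑ l, r i l x ^ 2 else 0 := by
      intro p
      rw [hσt p, ← sum_mul]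
      by_cases hp : p = i
      · subst hp; rw [if_pos rfl, if_pos rfl]; ring
      · rw [if_neg hp, if_neg hp]; ring
    rw [sum_congr rfl fun p _ => e4 p, sum_add_distrib, sum_sub_distrib,
      sum_ite_eq' univ i, if_pos (mem_univ i), sum_neg_distrib]
  have hθd : HasDerivAt (fun s : ℝ => θ j i (x + s • Pi.single i 1))
      (r i i x * θ j i x - r i j x * (h i x * (h j x)⁻¹ * θ j i x) - Ω i j x) 0 := by
    have hΩ' : Ω i j x = (t j - θ j i x
        + ∑ k, ∑ l, r i l x * r j k x * ((x l - x k) * r k l x)) / (x j - x i) := by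
      rw [hΩ i j hij x hx, t_ne j hij.symm]
      simp only [hv _ _ x hx]
    rw [hΩ']
    refine (hasDerivAt_theta (fun a b => r a b x) (fun a b => rsymm' a b x) x t i j hij
      (hdist x hx i j hij) ρ _ (θ j i x) (fun k s => (x + s • (Pi.single i 1 : Fin N → ℝ)) k)
      (fun k s => r i k (x + s • Pi.single i 1)) (fun k s => r j k (x + s • Pi.single i 1))
      (by simp) (by simp) (by simp) hud had hbd ?_ (hθ' j i hij.symm x hx)).congr_of_eventuallyEq ?_
    · intro k hk
      rw [t_ne k hk, hθ' i k hk.symm x hx,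
        div_mul_cancel₀ _ (sub_ne_zero.mpr (hdist x hx k i hk))]
    · filter_upwards [hline] with s hs
      exact hθ' j i hij.symm _ hs
  obtain ⟨C, hC⟩ := hC1
  have hD := deriv_sum_div_eq (fun a b => r a b x) (fun a b => rsymm' a b x) (fun k => h k x) t σ i
    (fun k => hne k x hx) ρ C (fun a b s => r a b (x + s • Pi.single i 1))
    (fun k s => h k (x + s • Pi.single i 1)) (by simp) (by simp) hhd hrd
    (by filter_upwards [hline] with s hs using hC _ hs)
  rw [hσ3] at hD
  have hdG := deriv_reduced_relation_eq_zero (fun a b => r a b x) (fun k => h k x) t i j hij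
    (fun k => hne k x hx) ρ _ (θ j i x) _ (fun k s => r i k (x + s • Pi.single i 1))
    (fun k s => r j k (x + s • Pi.single i 1)) (fun k s => h k (x + s • Pi.single i 1))
    (fun s => θ j i (x + s • Pi.single i 1)) (by simp) (by simp) (by simp) (by simp) hhd had hbd hθd
    (by filter_upwards [hline] with s hs using hG j hij.symm _ hs)
  have hmain := omega_identity_of_relations (fun a b => r a b x) (fun a b => rsymm' a b x)
    (fun k => h k x) t i j hij.symm (fun k => hne k x hx) (fun k => hstring k x hx) t_self ρ _
    (θ j i x) _ (Ω i j x)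
    (fun k hk => by
      have h1 := hG k hk x hx
      have h2 := hswap k hk x hx
      rw [t_ne k hk]
      linear_combination h1 + (h k x * (h i x)⁻¹ - h i x * (h k x)⁻¹) * h2)
    hρ' rfl (by rw [t_ne j hij.symm]; linear_combination hswap j hij.symm x hx) rfl hD hdG
  have hfilter : ∑ k ∈ univ.filter (fun k => k ≠ i), θ i k x * r j k x * h j x / h i x
      = ∑ k, t k * r j k x * h j x / h i x := by
    rw [sum_filter]
    refine sum_congr rfl fun k _ => ?_
    by_cases hk : k = i
    · simp [hk, t_self]
    · rw [if_pos hk, t_ne k hk]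
  rw [hfilter, ← t_ne j hij.symm]
  exact hmain
end
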